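/- For every σ ≥ 2 there exists a constant C > 0 (depending only on σ) such that for all k ≥ 2, all g > 0, and all integers w ≥ (σ/(σ−1))·N·(ln N + g) where N = σ^k, one has σ^{−k} ≤ DR_σ(k,w) ≤ (1 + C·e^{−g})·σ^{−k}. -/

import Mathlib

open Finset

/-- The `i`-th length-`k` substring (`k`-mer) of a word of length `w + k`
over the alphabet `Fin σ`. -/
def kmerAt (σ k w : ℕ) (v : Fin (w + k) → Fin σ) (i : Fin (w + 1)) : Fin k → Fin σ :=
  fun j => v ⟨i.1 + j.1, by have h1 := i.2; have h2 := j.2; omega⟩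

/-- `v` is a gamechanger with respect to the linear order (ranking) `ρ` on `k`-mers:
either its `k`-prefix is a `ρ`-minimal `k`-mer of `v`, or its `k`-suffix is a
`ρ`-minimal `k`-mer of `v` occurring exactly once in `v`. -/
def IsGC (σ k w : ℕ) (ρ : (Fin k → Fin σ) ≃ Fin (σ ^ k)) (v : Fin (w + k) → Fin σ) : Prop :=
  (∀ i : Fin (w + 1), ρ (kmerAt σ k w v 0) ≤ ρ (kmerAt σ k w v i)) ∨
  ((∀ i : Fin (w + 1), ρ (kmerAt σ k w v (Fin.last w)) ≤ ρ (kmerAt σ k w v i)) ∧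
    (∀ i : Fin (w + 1), kmerAt σ k w v i = kmerAt σ k w v (Fin.last w) → i = Fin.last w))

/-- `P_{σ,k}(v)`: the fraction of linear orders `ρ` on `σ`-ary `k`-strings for which
`v` is a gamechanger. -/
noncomputable def Pgc (σ k w : ℕ) (v : Fin (w + k) → Fin σ) : ℝ :=
  (Nat.card {ρ : (Fin k → Fin σ) ≃ Fin (σ ^ k) // IsGC σ k w ρ v} : ℝ) /
    (Nat.card ((Fin k → Fin σ) ≃ Fin (σ ^ k)) : ℝ)

/-- `D_ρ`: the fraction of gamechangers among all `σ`-ary strings of length `w + k`. -/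
noncomputable def Dens (σ k w : ℕ) (ρ : (Fin k → Fin σ) ≃ Fin (σ ^ k)) : ℝ :=
  (Nat.card {v : Fin (w + k) → Fin σ // IsGC σ k w ρ v} : ℝ) / ((σ : ℝ) ^ (w + k))

/-- `DR_σ(k,w)`: the expected density, i.e. the average of `D_ρ` over all orders `ρ`. -/
noncomputable def DR (σ k w : ℕ) : ℝ :=
  (∑ ρ : (Fin k → Fin σ) ≃ Fin (σ ^ k), Dens σ k w ρ) /
    (Nat.card ((Fin k → Fin σ) ≃ Fin (σ ^ k)) : ℝ)

/-- `DFR_σ(k,w) = (w+1) · DR_σ(k,w)`, the expected density factor. -/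
noncomputable def DFR (σ k w : ℕ) : ℝ := ((w : ℝ) + 1) * DR σ k w

/-- The number of distinct `k`-mers of `v`. -/
def numKmers (σ k w : ℕ) (v : Fin (w + k) → Fin σ) : ℕ :=
  (Finset.univ.image (kmerAt σ k w v)).card

/-- `Rep_{σ,k,w}`: the set of `σ`-ary strings of length `w + k` that contain two equal
`k`-substrings at distinct positions. -/
def RepSet (σ k w : ℕ) : Finset (Fin (w + k) → Fin σ) :=
  Finset.univ.filter fun v =>
    ∃ i j : Fin (w + 1), i ≠ j ∧ kmerAt σ k w v i = kmerAt σ k w v j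

/-- `Dev_σ(k,w)`, the deviation of the random order. -/
noncomputable def Dev (σ k w : ℕ) : ℝ :=
  (∑ v ∈ RepSet σ k w, Pgc σ k w v) - (2 / ((w : ℝ) + 1)) * ((RepSet σ k w).card : ℝ)

/-- `p` is a period of the string `s` (of length `n`): `s[i] = s[i+p]` whenever both
positions are inside `s`. -/
def HasPeriod (σ n : ℕ) (s : Fin n → Fin σ) (p : ℕ) : Prop :=
  ∀ (i : ℕ) (h : i + p < n), s ⟨i, by omega⟩ = s ⟨i + p, h⟩

/-- A string is primitive if it is not of the form `u^m` with `m ≥ 2`, equivalently it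
has no period that is a proper divisor of its length. -/
def IsPrimitive (σ n : ℕ) (s : Fin n → Fin σ) : Prop :=
  ¬ ∃ d, d ∣ n ∧ d < n ∧ HasPeriod σ n s d

/-- `Prim_σ(n)`: the number of primitive `σ`-ary strings of length `n`. -/
noncomputable def Prim (σ n : ℕ) : ℕ :=
  Nat.card {s : Fin n → Fin σ // IsPrimitive σ n s}

/-- The substring of `v` of length `ℓ` starting at (0-indexed) position `i`. -/
def subAt (σ n : ℕ) (v : Fin n → Fin σ) (i ℓ : ℕ) (h : i + ℓ ≤ n) : Fin ℓ → Fin σ :=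
  fun j => v ⟨i + j.1, by have := j.2; omega⟩

/-- A string is `p`-periodic if `p` is its minimal period and `p ≤ |s|/2`. -/
def IsPPeriodic (σ n : ℕ) (s : Fin n → Fin σ) (p : ℕ) : Prop :=
  1 ≤ p ∧ 2 * p ≤ n ∧ HasPeriod σ n s p ∧ ∀ q, 1 ≤ q → q < p → ¬ HasPeriod σ n s q

/-- The occurrence `v[i..i+ℓ)` is a run of period `p`: it is `p`-periodic and is not
contained in a longer `p`-periodic substring of `v`. -/
def IsRun (σ n : ℕ) (v : Fin n → Fin σ) (i ℓ p : ℕ) (h : i + ℓ ≤ n) : Prop :=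
  IsPPeriodic σ ℓ (subAt σ n v i ℓ h) p ∧
    ∀ (i' ℓ' : ℕ) (h' : i' + ℓ' ≤ n), i' ≤ i → i + ℓ ≤ i' + ℓ' → ℓ < ℓ' →
      ¬ IsPPeriodic σ ℓ' (subAt σ n v i' ℓ' h') p

/-- A major run: a run `x` of period `p` with `|x| ≥ |v|/2 + p`. -/
def IsMajorRun (σ n : ℕ) (v : Fin n → Fin σ) (i ℓ p : ℕ) (h : i + ℓ ≤ n) : Prop :=
  IsRun σ n v i ℓ p h ∧ n + 2 * p ≤ 2 * ℓ

/-- Words of length `n` as lists. -/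
def wds (σ n : ℕ) : Finset (List (Fin σ)) :=
  Finset.univ.image (fun f : Fin n → Fin σ => List.ofFn f)

lemma mem_wds {σ n : ℕ} {l : List (Fin σ)} : l ∈ wds σ n ↔ l.length = n := by
  unfold wds
  simp only [Finset.mem_image, Finset.mem_univ, true_and]
  constructor
  · rintro ⟨f, rfl⟩; simp
  · rintro rfl; exact ⟨l.get, List.ofFn_get l⟩

lemma card_wds (σ n : ℕ) : (wds σ n).card = σ ^ n := by
  unfold wds
  rw [Finset.card_image_of_injective _ List.ofFn_injective]
  simp

/-- Words of length `n` avoiding `m`. -/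
def EE (σ : ℕ) (m : List (Fin σ)) (n : ℕ) : Finset (List (Fin σ)) :=
  (wds σ n).filter fun l => ¬ m <:+: l

/-- Words of length `n` whose first occurrence of `m` is at the end. -/
def FF (σ : ℕ) (m : List (Fin σ)) (n : ℕ) : Finset (List (Fin σ)) :=
  (wds σ n).filter fun l => m <:+: l ∧ ¬ m <:+: l.dropLast

lemma step1 (σ : ℕ) (m : List (Fin σ)) (n : ℕ) :
    (EE σ m (n+1)).card + (FF σ m (n+1)).card ≤ σ * (EE σ m n).card := by
  have hd : Disjoint (EE σ m (n+1)) (FF σ m (n+1)) := by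
    rw [Finset.disjoint_left]
    intro l h1 h2
    simp only [EE, FF, Finset.mem_filter] at h1 h2
    exact h1.2 h2.2.1
  rw [← Finset.card_union_of_disjoint hd]
  have hs : EE σ m (n+1) ∪ FF σ m (n+1) ⊆
      ((Finset.univ : Finset (Fin σ)) ×ˢ EE σ m n).image (fun p => p.2 ++ [p.1]) := by
    intro l hl
    have hlen : l.length = n + 1 := by
      simp only [EE, FF, Finset.mem_union, Finset.mem_filter, mem_wds] at hl
      tauto
    have hav : ¬ m <:+: l.dropLast := by
      simp only [EE, FF, Finset.mem_union, Finset.mem_filter, mem_wds] at hl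
      rcases hl with hl | hl
      · intro h
        exact hl.2 (h.trans (List.dropLast_prefix l).isInfix)
      · exact hl.2.2
    have hne : l ≠ [] := by rintro rfl; simp at hlen
    rw [Finset.mem_image]
    refine ⟨(l.getLast hne, l.dropLast), ?_, List.dropLast_append_getLast hne⟩
    simp [EE, mem_wds, hlen, hav]
  calc _ ≤ _ := Finset.card_le_card hs
    _ ≤ _ := Finset.card_image_le
    _ = _ := by simp

lemma step2 (σ : ℕ) (m : List (Fin σ)) (n : ℕ) (hn : m.length ≤ n) :
    (FF σ m (n+1)).card ≤ σ * (FF σ m n).card := by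
  have hs : FF σ m (n+1) ⊆
      ((Finset.univ : Finset (Fin σ)) ×ˢ FF σ m n).image (fun p => p.1 :: p.2) := by
    intro l hl
    simp only [FF, Finset.mem_filter, mem_wds] at hl
    obtain ⟨hlen, hin, hav⟩ := hl
    cases l with
    | nil => simp at hlen
    | cons a l =>
      rw [Finset.mem_image]
      refine ⟨(a, l), ?_, rfl⟩
      have hl' : l.length = n := by simpa using hlen
      simp only [FF, Finset.mem_product, Finset.mem_univ, true_and, Finset.mem_filter, mem_wds]
      refine ⟨hl', ?_, ?_⟩
      · rcases List.infix_cons_iff.1 hin with h | h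
        · exfalso
          apply hav
          have : m <+: (a :: l).dropLast := by
            rw [List.dropLast_eq_take, List.prefix_take_iff]
            refine ⟨h, ?_⟩
            simp [hl']
            exact hn
          exact this.isInfix
        · exact h
      · intro h
        apply hav
        rcases l with _ | ⟨b, l⟩
        · simp only [List.dropLast_nil] at h
          simpa using h
        · rw [List.dropLast_cons_cons]
          exact h.trans (List.suffix_cons _ _).isInfix
  calc _ ≤ _ := Finset.card_le_card hs
    _ ≤ _ := Finset.card_image_le
    _ = _ := by simp

lemma step3 (σ : ℕ) (m : List (Fin σ)) (n : ℕ) :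
    (EE σ m n).card ≤ ∑ i ∈ Finset.range m.length, (FF σ m (n+1+i)).card := by
  have hs : EE σ m n ⊆ (Finset.range m.length).biUnion
      (fun i => (FF σ m (n+1+i)).image (List.take n)) := by
    intro u hu
    simp only [EE, Finset.mem_filter, mem_wds] at hu
    obtain ⟨hlen, hav⟩ := hu
    have hex : ∃ j, m <:+: u ++ m.take j :=
      ⟨m.length, by rw [List.take_length]; exact (List.suffix_append _ _).isInfix⟩
    classical
    obtain ⟨j, hj, hmin⟩ : ∃ j, (m <:+: u ++ m.take j) ∧ ∀ i < j, ¬ (m <:+: u ++ m.take i) :=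
      ⟨Nat.find hex, Nat.find_spec hex, fun i hi => Nat.find_min hex hi⟩
    have hjk : j ≤ m.length := by
      by_contra hc
      push Not at hc
      apply hmin _ hc
      rw [List.take_length]; exact (List.suffix_append _ _).isInfix
    rcases j with _ | j
    · simp at hj; exact absurd hj hav
    rw [Finset.mem_biUnion]
    refine ⟨j, Finset.mem_range.2 hjk, ?_⟩
    rw [Finset.mem_image]
    refine ⟨u ++ m.take (j+1), ?_, ?_⟩
    · simp only [FF, Finset.mem_filter, mem_wds]
      refine ⟨?_, hj, ?_⟩
      · simp [hlen]; omega
      · have : (u ++ m.take (j+1)).dropLast = u ++ m.take j := by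
          rw [List.dropLast_append_of_ne_nil, List.dropLast_eq_take, List.take_take, List.length_take, min_eq_left (by omega), min_eq_left hjk]
          · simp
          · intro h
            have := congrArg List.length h
            simp at this
            subst this
            simp at hjk
        rw [this]
        exact hmin _ (by omega)
    · rw [← hlen, List.take_left]
  calc _ ≤ _ := Finset.card_le_card hs
    _ ≤ _ := Finset.card_biUnion_le
    _ ≤ _ := Finset.sum_le_sum fun i _ => Finset.card_image_le

lemma step2' (σ : ℕ) (m : List (Fin σ)) (n : ℕ) (hn : m.length ≤ n) (i : ℕ) :
    (FF σ m (n+i)).card ≤ σ ^ i * (FF σ m n).card := by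
  induction i with
  | zero => simp
  | succ i ih =>
    calc _ ≤ σ * (FF σ m (n+i)).card := step2 σ m (n+i) (by omega)
      _ ≤ σ * (σ ^ i * (FF σ m n).card) := Nat.mul_le_mul_left _ ih
      _ = _ := by ring

lemma step4 (σ : ℕ) (hσ : 2 ≤ σ) (m : List (Fin σ)) (n : ℕ) (hn : m.length ≤ n + 1) :
    ((EE σ m (n+1)).card : ℝ) ≤
      σ * (1 - ((σ : ℝ) - 1) / (σ * (σ : ℝ) ^ m.length)) * (EE σ m n).card := by
  have h1 : ((EE σ m (n+1)).card : ℝ) + (FF σ m (n+1)).card ≤ σ * (EE σ m n).card := by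
    exact_mod_cast step1 σ m n
  have h3 : (EE σ m n).card ≤ (∑ i ∈ Finset.range m.length, σ ^ i) * (FF σ m (n+1)).card := by
    rw [Finset.sum_mul]
    exact (step3 σ m n).trans (Finset.sum_le_sum fun i _ => step2' σ m (n+1) hn i)
  have h3' : ((EE σ m n).card : ℝ) ≤
      (∑ i ∈ Finset.range m.length, (σ : ℝ) ^ i) * (FF σ m (n+1)).card := by
    exact_mod_cast h3
  have hs : (2 : ℝ) ≤ σ := by exact_mod_cast hσ
  have hg := geom_sum_mul (σ : ℝ) m.length
  set S := ∑ i ∈ Finset.range m.length, (σ : ℝ) ^ i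
  set N := (σ : ℝ) ^ m.length with hN
  have hNp : 0 < N := by positivity
  have h5 : (σ - 1) * ((EE σ m n).card : ℝ) ≤ N * (FF σ m (n+1)).card := by
    have := mul_le_mul_of_nonneg_left h3' (by linarith : (0:ℝ) ≤ σ - 1)
    have hf : (0:ℝ) ≤ (FF σ m (n+1)).card := by positivity
    nlinarith
  have h6 : (σ - 1) / N * ((EE σ m n).card : ℝ) ≤ (FF σ m (n+1)).card := by
    rw [div_mul_eq_mul_div, div_le_iff₀ hNp]; linarith
  have h7 : σ * (1 - ((σ : ℝ) - 1) / (σ * N)) = σ - (σ - 1) / N := by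
    field_simp
  rw [h7]
  linarith

lemma step5 (σ : ℕ) (hσ : 2 ≤ σ) (m : List (Fin σ)) (k : ℕ) (hm : m.length = k + 1) (w : ℕ) :
    ((EE σ m (k + w)).card : ℝ) ≤
      (σ : ℝ) ^ (k + w) * (1 - ((σ : ℝ) - 1) / (σ * (σ : ℝ) ^ (k + 1))) ^ w := by
  have hs : (2 : ℝ) ≤ σ := by exact_mod_cast hσ
  have hx : 0 ≤ 1 - ((σ : ℝ) - 1) / (σ * (σ : ℝ) ^ (k + 1)) := by
    rw [sub_nonneg, div_le_one (by positivity)]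
    have : (1:ℝ) ≤ (σ : ℝ) ^ (k + 1) := one_le_pow₀ (by linarith)
    nlinarith
  induction w with
  | zero =>
    have : (EE σ m k).card ≤ σ ^ k := by
      rw [← card_wds]; exact Finset.card_filter_le _ _
    simpa using (by exact_mod_cast this : ((EE σ m k).card : ℝ) ≤ (σ : ℝ) ^ k)
  | succ w ih =>
    have h := step4 σ hσ m (k + w) (by omega)
    rw [hm] at h
    refine (h.trans (mul_le_mul_of_nonneg_left ih (by positivity))).trans (le_of_eq ?_)
    ring

lemma gc_upper (σ k w : ℕ) (ρ : (Fin k → Fin σ) ≃ Fin (σ ^ k)) (a : Fin k → Fin σ)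
    (ha : ∀ b, ρ a ≤ ρ b) :
    Nat.card {v : Fin (w + 1 + k) → Fin σ // IsGC σ k (w + 1) ρ v} ≤
      σ ^ (w + 1) + σ * (EE σ (List.ofFn a) (w + k)).card := by
  classical
  rw [Nat.card_eq_fintype_card, Fintype.card_subtype]
  have key : ∀ v : Fin (w + 1 + k) → Fin σ, IsGC σ k (w + 1) ρ v →
      kmerAt σ k (w+1) v 0 = a ∨ ¬ List.ofFn a <:+: (List.ofFn v).dropLast := by
    intro v hv
    by_contra hc
    push Not at hc
    obtain ⟨h0, hin⟩ := hc
    obtain ⟨s, t, hst⟩ := hin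
    have hlen := congrArg List.length hst
    simp at hlen
    have hi : s.length < w + 1 := by omega
    have hocc : kmerAt σ k (w+1) v ⟨s.length, by omega⟩ = a := by
      funext j
      simp only [kmerAt]
      have h1 : (s ++ List.ofFn a ++ t)[s.length + j.1]? = some (a j) := by
        rw [List.append_assoc, List.getElem?_append_right (by omega),
          List.getElem?_append_left (by simp)]
        simp
      have hj := j.2
      rw [hst, List.getElem?_dropLast, if_pos (by simp; omega), List.getElem?_ofFn,
        dif_pos (by omega)] at h1
      exact Option.some.inj h1
    have huniq : ∀ b, ρ b ≤ ρ a → b = a := fun b hb => ρ.injective (le_antisymm hb (ha b))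
    rcases hv with hv | ⟨hv1, hv2⟩
    · apply h0
      apply huniq
      have := hv ⟨s.length, by omega⟩
      rwa [hocc] at this
    · have hl := hv1 ⟨s.length, by omega⟩
      rw [hocc] at hl
      have := hv2 ⟨s.length, by omega⟩ (by rw [hocc, huniq _ hl])
      have := congrArg Fin.val this
      simp at this
      omega
  rw [← Finset.card_image_of_injective _ (List.ofFn_injective (α := Fin σ) (n := w + 1 + k))]
  have hs : ((Finset.univ.filter fun v => IsGC σ k (w+1) ρ v).image List.ofFn) ⊆
      (wds σ (w+1)).image (fun u => List.ofFn a ++ u) ∪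
      ((Finset.univ : Finset (Fin σ)) ×ˢ EE σ (List.ofFn a) (w+k)).image
        (fun p => p.2 ++ [p.1]) := by
    intro l hl
    simp only [Finset.mem_image, Finset.mem_filter, Finset.mem_univ, true_and] at hl
    obtain ⟨v, hv, rfl⟩ := hl
    rw [Finset.mem_union]
    rcases key v hv with h | h
    · left
      rw [Finset.mem_image]
      refine ⟨(List.ofFn v).drop k, by simp [mem_wds], ?_⟩
      have : List.ofFn a = (List.ofFn v).take k := by
        apply List.ext_getElem
        · simp
        · intro i h1 h2
          simp only [List.length_ofFn] at h1
          have := congrFun h ⟨i, h1⟩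
          simp [kmerAt] at this
          simp [this]
      rw [this, List.take_append_drop]
    · right
      have hlen : (List.ofFn v).length = w + 1 + k := by simp
      have hne : List.ofFn v ≠ [] := by intro h; rw [h] at hlen; simp at hlen; omega
      rw [Finset.mem_image]
      refine ⟨((List.ofFn v).getLast hne, (List.ofFn v).dropLast), ?_,
        List.dropLast_append_getLast hne⟩
      simp only [EE, Finset.mem_product, Finset.mem_univ, true_and, Finset.mem_filter, mem_wds]
      refine ⟨?_, h⟩
      simp
  calc _ ≤ _ := Finset.card_le_card hs
    _ ≤ _ := Finset.card_union_le _ _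
    _ ≤ _ := Nat.add_le_add Finset.card_image_le Finset.card_image_le
    _ = _ := by simp [card_wds]

lemma gc_lower (σ k w : ℕ) (ρ : (Fin k → Fin σ) ≃ Fin (σ ^ k)) (a : Fin k → Fin σ)
    (ha : ∀ b, ρ a ≤ ρ b) :
    σ ^ w ≤ Nat.card {v : Fin (w + k) → Fin σ // IsGC σ k w ρ v} := by
  let F : (Fin w → Fin σ) → {v : Fin (w + k) → Fin σ // IsGC σ k w ρ v} := fun u =>
    ⟨fun i => if h : i.1 < k then a ⟨i.1, h⟩ else u ⟨i.1 - k, by have := i.2; omega⟩, by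
      left
      intro i
      have : kmerAt σ k w (fun i => if h : i.1 < k then a ⟨i.1, h⟩
          else u ⟨i.1 - k, by have := i.2; omega⟩) 0 = a := by
        funext j
        simp [kmerAt]
      rw [this]
      exact ha _⟩
  have hF : Function.Injective F := by
    intro u u' h
    funext i
    have := congrFun (congrArg Subtype.val h) ⟨i.1 + k, by have := i.2; omega⟩
    simpa [F] using this
  have := Nat.card_le_card_of_injective F hF
  simpa using this

theorem stmt19 (σ : ℕ) (hσ : 2 ≤ σ) :
    ∃ C : ℝ, 0 < C ∧ ∀ k : ℕ, 2 ≤ k → ∀ g : ℝ, 0 < g → ∀ w : ℕ,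
      ((σ : ℝ) / ((σ : ℝ) - 1)) * (σ : ℝ) ^ k * (Real.log ((σ : ℝ) ^ k) + g) ≤ (w : ℝ) →
      ((σ : ℝ) ^ k)⁻¹ ≤ DR σ k w ∧ DR σ k w ≤ (1 + C * Real.exp (-g)) * ((σ : ℝ) ^ k)⁻¹ := by
  refine ⟨1, one_pos, ?_⟩
  intro k hk g hg w hw
  have hs : (2 : ℝ) ≤ σ := by exact_mod_cast hσ
  have hs1 : (0 : ℝ) < σ - 1 := by linarith
  have hNp : (0:ℝ) < (σ : ℝ) ^ k := by positivity
  have hN1 : (1:ℝ) ≤ (σ : ℝ) ^ k := one_le_pow₀ (by linarith)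
  have hNpos : 0 < σ ^ k := by positivity
  have hwpos : 0 < w := by
    have h1 : 0 < Real.log ((σ : ℝ) ^ k) + g := by
      have := Real.log_nonneg hN1
      linarith
    have h2 : (0:ℝ) < w := lt_of_lt_of_le (by positivity) hw
    exact_mod_cast h2
  have hdens : ∀ ρ : (Fin k → Fin σ) ≃ Fin (σ ^ k), ((σ : ℝ) ^ k)⁻¹ ≤ Dens σ k w ρ ∧
      Dens σ k w ρ ≤ (1 + 1 * Real.exp (-g)) * ((σ : ℝ) ^ k)⁻¹ := by
    intro ρ
    have ha : ∀ b, ρ (ρ.symm ⟨0, hNpos⟩) ≤ ρ b := by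
      intro b
      rw [Equiv.apply_symm_apply]
      exact Fin.mk_le_of_le_val (Nat.zero_le _)
    have hT : (0:ℝ) < (σ:ℝ) ^ (w + k) := by positivity
    unfold Dens
    constructor
    · have h := gc_lower σ k w ρ _ ha
      have h' : (σ:ℝ) ^ w ≤ (Nat.card {v : Fin (w + k) → Fin σ // IsGC σ k w ρ v} : ℝ) := by
        exact_mod_cast h
      rw [le_div_iff₀ hT, pow_add]
      calc _ = (σ:ℝ) ^ w := by field_simp
        _ ≤ _ := h'
    · obtain ⟨W, rfl⟩ : ∃ W, w = W + 1 := ⟨w - 1, by omega⟩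
      obtain ⟨K, rfl⟩ : ∃ K, k = K + 1 := ⟨k - 1, by omega⟩
      have h := gc_upper σ (K+1) W ρ _ ha
      have h5 := step5 σ hσ (List.ofFn (ρ.symm ⟨0, hNpos⟩)) K (by simp) (W + 1)
      rw [show K + (W + 1) = W + (K + 1) by ring] at h5
      set e := (EE σ (List.ofFn (ρ.symm ⟨0, hNpos⟩)) (W + (K + 1))).card
      have h' : (Nat.card {v : Fin (W + 1 + (K + 1)) → Fin σ // IsGC σ (K+1) (W + 1) ρ v} : ℝ)
          ≤ (σ:ℝ) ^ (W+1) + σ * e := by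
        exact_mod_cast h
      have hx : 0 ≤ 1 - ((σ : ℝ) - 1) / (σ * (σ : ℝ) ^ (K + 1)) := by
        rw [sub_nonneg, div_le_one (by positivity)]
        nlinarith
      have hexp : (1 - ((σ : ℝ) - 1) / (σ * (σ : ℝ) ^ (K + 1))) ^ (W + 1) ≤
          Real.exp (-g) * ((σ : ℝ) ^ (K + 1))⁻¹ := by
        calc _ ≤ (Real.exp (-(((σ : ℝ) - 1) / (σ * (σ : ℝ) ^ (K + 1))))) ^ (W + 1) :=
              pow_le_pow_left₀ hx (Real.one_sub_le_exp_neg _) _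
          _ = Real.exp (-(((σ : ℝ) - 1) / (σ * (σ : ℝ) ^ (K + 1)) * ((W + 1 : ℕ) : ℝ))) := by
              rw [← Real.exp_nat_mul]; congr 1; ring
          _ ≤ Real.exp (-(Real.log ((σ : ℝ) ^ (K+1)) + g)) := by
              apply Real.exp_le_exp.2
              apply neg_le_neg
              have h9 := mul_le_mul_of_nonneg_left hw
                (by positivity : 0 ≤ ((σ : ℝ) - 1) / (σ * (σ : ℝ) ^ (K + 1)))
              refine le_trans (le_of_eq ?_) h9
              have : (σ:ℝ) - 1 ≠ 0 := hs1.ne'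
              generalize Real.log ((σ : ℝ) ^ (K+1)) = L
              field_simp
          _ = _ := by
              rw [neg_add, Real.exp_add, Real.exp_neg (Real.log _), Real.exp_log hNp]
              ring
      rw [div_le_iff₀ hT]
      have h6 := h5.trans (mul_le_mul_of_nonneg_left hexp (by positivity))
      have h8 := mul_le_mul_of_nonneg_left h6 (by linarith : (0:ℝ) ≤ σ)
      refine (h'.trans (add_le_add_right h8 _)).trans (le_of_eq ?_)
      rw [pow_add _ (W+1) (K+1), pow_add _ W (K+1), pow_succ _ W]
      generalize (σ:ℝ)^(K+1) = N at hNp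
      field_simp
      try ring
  have hcard : (Nat.card ((Fin k → Fin σ) ≃ Fin (σ ^ k)) : ℝ) =
      ((Finset.univ : Finset ((Fin k → Fin σ) ≃ Fin (σ ^ k))).card : ℝ) := by
    rw [Nat.card_eq_fintype_card, Finset.card_univ]
  have hne : Nonempty ((Fin k → Fin σ) ≃ Fin (σ ^ k)) :=
    ⟨Fintype.equivOfCardEq (by simp)⟩
  have hcp : (0:ℝ) < ((Finset.univ : Finset ((Fin k → Fin σ) ≃ Fin (σ ^ k))).card : ℝ) := by
    exact_mod_cast Finset.card_pos.2 Finset.univ_nonempty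
  unfold DR
  rw [hcard, le_div_iff₀ hcp, div_le_iff₀ hcp]
  constructor
  · rw [mul_comm, ← nsmul_eq_mul]
    exact Finset.card_nsmul_le_sum _ _ _ fun ρ _ => (hdens ρ).1
  · rw [mul_comm, ← nsmul_eq_mul]
    exact Finset.sum_le_card_nsmul _ _ _ fun ρ _ => (hdens ρ).2
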